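/- For every integer i ≥ 3, Player 1 has a winning strategy in the reversed Zeckendorf game on n = F_{i+1} + F_{i-2}; that is, the Zeckendorf decomposition z(n) of n = F_{i+1} + F_{i-2} is a first-player win. -/

import Mathlib

/-- The Fibonacci numbers indexed so that `zfib 1 = 1`, `zfib 2 = 2`,
and `zfib (i+1) = zfib i + zfib (i-1)`. -/
def zfib (i : ℕ) : ℕ := Nat.fib (i + 1)

/-- A game state: a finitely supported function recording the height of each bin.
Bin indices start at `1`; index `0` is unused. -/
abbrev ZState := ℕ →₀ ℕ

/-- The legal moves of the reversed Zeckendorf game. -/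
inductive ZMove : ZState → ZState → Prop
  | split (h : ZState) (i : ℕ) (hi : 2 ≤ i) (hpos : 0 < h (i + 1)) :
      ZMove h (h - Finsupp.single (i + 1) 1 + Finsupp.single i 1 + Finsupp.single (i - 1) 1)
  | splitTwo (h : ZState) (hpos : 0 < h 2) :
      ZMove h (h - Finsupp.single 2 1 + Finsupp.single 1 2)
  | combine (h : ZState) (i : ℕ) (hi : 2 < i) (h1 : 0 < h (i + 1)) (h2 : 0 < h (i - 2)) :
      ZMove h (h - Finsupp.single (i + 1) 1 - Finsupp.single (i - 2) 1 + Finsupp.single i 2)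
  | combineTwo (h : ZState) (h1 : 0 < h 3) (h2 : 0 < h 1) :
      ZMove h (h - Finsupp.single 3 1 - Finsupp.single 1 1 + Finsupp.single 2 2)

mutual
  /-- The state is a first-player win: some legal move leads to a state that is a
  loss for the player then to move. -/
  inductive ZFirstWin : ZState → Prop
    | intro (h h' : ZState) (m : ZMove h h') (hl : ZLoss h') : ZFirstWin h
  /-- The state is a loss for the player to move (i.e., not a first-player win):
  every legal move leads to a first-player win for the opponent. -/
  inductive ZLoss : ZState → Prop
    | intro (h : ZState) (hall : ∀ h', ZMove h h' → ZFirstWin h') : ZLoss h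
end

/-- `z` is the Zeckendorf decomposition of `n`: heights are `0` or `1`,
no two adjacent bins are occupied, bin `0` is unused, and the total value is `n`. -/
def IsZeckendorf (n : ℕ) (z : ZState) : Prop :=
  z 0 = 0 ∧ (∀ i, z i ≤ 1) ∧ (∀ i, ¬(0 < z i ∧ 0 < z (i + 1))) ∧
    (z.sum fun i v => v * zfib i) = n

/-- Potential function. -/
noncomputable def zpot : ZState →+ ℕ :=
  Finsupp.liftAddHom (fun i => AddMonoidHom.mulRight (3 ^ i))

lemma zpot_single (i v : ℕ) : zpot (Finsupp.single i v) = v * 3 ^ i := by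
  simp [zpot]

lemma zpot_sub (h : ZState) (i : ℕ) (hp : 0 < h i) :
    zpot (h - Finsupp.single i 1) + 3 ^ i = zpot h := by
  have e : h - Finsupp.single i 1 + Finsupp.single i 1 = h := by
    apply tsub_add_cancel_of_le
    rw [Finsupp.single_le_iff]
    omega
  conv_rhs => rw [← e]
  rw [map_add, zpot_single, one_mul]

lemma zpot_lt {h h' : ZState} (m : ZMove h h') : zpot h' < zpot h := by
  cases m with
  | split i hi hpos =>
    have := zpot_sub h _ hpos
    obtain ⟨k, rfl⟩ : ∃ k, i = k + 1 := ⟨i - 1, by omega⟩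
    simp only [map_add, zpot_single, Nat.add_sub_cancel]
    have : 0 < 3 ^ k := by positivity
    simp only [pow_succ] at *
    omega
  | splitTwo hpos =>
    have := zpot_sub h _ hpos
    simp only [map_add, zpot_single]
    omega
  | combine i hi h1 h2 =>
    have a := zpot_sub h _ h1
    have b := zpot_sub (h - Finsupp.single (i + 1) 1) (i - 2) (by
      rw [Finsupp.tsub_apply, Finsupp.single_apply, if_neg (by omega)]
      omega)
    simp only [map_add, zpot_single]
    have : 0 < 3 ^ i := by positivity
    have : 0 < 3 ^ (i - 2) := by positivity
    simp only [pow_succ] at *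
    omega
  | combineTwo h1 h2 =>
    have a := zpot_sub h _ h1
    have b := zpot_sub (h - Finsupp.single 3 1) 1 (by
      rw [Finsupp.tsub_apply, Finsupp.single_apply, if_neg (by omega)]
      omega)
    simp only [map_add, zpot_single]
    omega

lemma zdet (n : ℕ) : ∀ h : ZState, zpot h = n → ZFirstWin h ∨ ZLoss h := by
  induction n using Nat.strong_induction_on with
  | _ n ih =>
    intro h hn
    by_cases hc : ∃ h', ZMove h h' ∧ ZLoss h'
    · obtain ⟨h', m, l⟩ := hc
      exact Or.inl (.intro h h' m l)
    · refine Or.inr (.intro h fun h' m => ?_)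
      rcases ih _ (hn ▸ zpot_lt m) h' rfl with w | l
      · exact w
      · exact absurd ⟨h', m, l⟩ hc

lemma zfib_rec (m : ℕ) : zfib (m + 2) = zfib m + zfib (m + 1) := by
  simp only [zfib]
  exact Nat.fib_add_two

lemma zsum_lt (f : ℕ → ℕ) (h0 : f 0 = 0) (h1 : ∀ i, f i ≤ 1)
    (h2 : ∀ i, ¬(0 < f i ∧ 0 < f (i + 1))) (m : ℕ) :
    ∑ k ∈ Finset.range (m + 1), f k * zfib k < zfib (m + 1) := by
  induction m using Nat.strong_induction_on with
  | _ m ih =>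
    match m, ih with
    | 0, _ => simp [h0, zfib]
    | 1, _ =>
      have := h1 1
      simp only [Finset.sum_range_succ, h0, zfib]
      norm_num [Nat.fib_add_two]
      omega
    | m + 2, ih =>
      have r := zfib_rec (m + 1)
      have i0 := ih m (by omega)
      have i1 := ih (m + 1) (by omega)
      have a := h1 (m + 2)
      have b := h2 (m + 1)
      rw [Finset.sum_range_succ]
      rcases Nat.eq_zero_or_pos (f (m + 2)) with h | h
      · rw [h]
        simp only [add_assoc, Nat.reduceAdd] at *
        omega
      · have e : f (m + 2) = 1 := by omega
        have e' : f (m + 1) = 0 := by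
          by_contra hne
          exact b ⟨by omega, h⟩
        rw [Finset.sum_range_succ, e, e']
        simp only [add_assoc, Nat.reduceAdd] at *
        omega

lemma zuniq (f g : ℕ → ℕ) (h0 : f 0 = 0) (h1 : ∀ i, f i ≤ 1)
    (h2 : ∀ i, ¬(0 < f i ∧ 0 < f (i + 1))) (g0 : g 0 = 0) (g1 : ∀ i, g i ≤ 1)
    (g2 : ∀ i, ¬(0 < g i ∧ 0 < g (i + 1))) (m : ℕ)
    (hs : ∑ k ∈ Finset.range (m + 1), f k * zfib k =
      ∑ k ∈ Finset.range (m + 1), g k * zfib k) : ∀ k ≤ m, f k = g k := by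
  induction m with
  | zero =>
    intro k hk
    obtain rfl : k = 0 := by omega
    rw [h0, g0]
  | succ m ih =>
    rw [Finset.sum_range_succ, Finset.sum_range_succ _ (m + 1)] at hs
    have a := zsum_lt f h0 h1 h2 m
    have b := zsum_lt g g0 g1 g2 m
    have c := h1 (m + 1)
    have d := g1 (m + 1)
    have e : f (m + 1) = g (m + 1) := by
      rcases (by omega : f (m + 1) = 0 ∨ f (m + 1) = 1) with p | p <;>
      rcases (by omega : g (m + 1) = 0 ∨ g (m + 1) = 1) with q | q <;>
      rw [p, q] at hs ⊢ <;> omega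
    rw [e] at hs
    intro k hk
    rcases (by omega : k ≤ m ∨ k = m + 1) with h | rfl
    · exact ih (by omega) k h
    · exact e

lemma isZeckendorf_unique {n : ℕ} {z w : ZState} (hz : IsZeckendorf n z)
    (hw : IsZeckendorf n w) : z = w := by
  obtain ⟨z0, z1, z2, z3⟩ := hz
  obtain ⟨w0, w1, w2, w3⟩ := hw
  ext k
  set M := k + z.support.sup id + w.support.sup id with hM
  have hzs : z.support ⊆ Finset.range (M + 1) := fun x hx => by
    have : x ≤ z.support.sup id := Finset.le_sup (f := id) hx
    rw [Finset.mem_range]; omega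
  have hws : w.support ⊆ Finset.range (M + 1) := fun x hx => by
    have : x ≤ w.support.sup id := Finset.le_sup (f := id) hx
    rw [Finset.mem_range]; omega
  rw [Finsupp.sum_of_support_subset _ hzs _ (by simp)] at z3
  rw [Finsupp.sum_of_support_subset _ hws _ (by simp)] at w3
  exact zuniq z w z0 z1 z2 w0 w1 w2 M (z3.trans w3.symm) k (by omega)

theorem reversedZeckendorf_firstPlayerWin_fib (i : ℕ) (hi : 3 ≤ i)
    (z : ZState) (hz : IsZeckendorf (zfib (i + 1) + zfib (i - 2)) z) :
    ZFirstWin z := by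
  obtain ⟨j, rfl⟩ : ∃ j, i = j + 3 := ⟨i - 3, by omega⟩
  have hz' : z = Finsupp.single (j + 4) 1 + Finsupp.single (j + 1) 1 := by
    refine isZeckendorf_unique hz ⟨?_, ?_, ?_, ?_⟩
    · simp
    · intro k
      simp only [Finsupp.add_apply, Finsupp.single_apply]
      split_ifs <;> omega
    · intro k
      simp only [Finsupp.add_apply, Finsupp.single_apply]
      split_ifs <;> omega
    · rw [Finsupp.sum_add_index' (by simp) (by intros; ring)]
      simp
  subst hz'
  set S : ZState := Finsupp.single (j + 3) 1 + Finsupp.single (j + 2) 1 +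
    Finsupp.single (j + 1) 1 with hS
  rcases zdet _ S rfl with w | l
  · refine .intro _ (Finsupp.single (j + 3) 2) ?_ (.intro _ fun h' m => ?_)
    · convert ZMove.combine (Finsupp.single (j + 4) 1 + Finsupp.single (j + 1) 1) (j + 3)
        (by omega) (by simp) (by simp) using 1
      ext k
      simp only [Finsupp.add_apply, Finsupp.tsub_apply, Finsupp.single_apply]
      split_ifs <;> omega
    · have key : h' = S := by
        generalize hg : (Finsupp.single (j + 3) 2 : ZState) = g at m
        cases m with
        | split i hi hpos =>
          subst hg
          rw [Finsupp.single_apply] at hpos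
          have : i = j + 2 := by split_ifs at hpos <;> omega
          subst this
          ext k
          simp only [hS, Finsupp.add_apply, Finsupp.tsub_apply, Finsupp.single_apply]
          split_ifs <;> omega
        | splitTwo hpos =>
          subst hg
          rw [Finsupp.single_apply] at hpos
          split_ifs at hpos <;> omega
        | combine i hi h1 h2 =>
          subst hg
          rw [Finsupp.single_apply] at h1 h2
          split_ifs at h1 h2 <;> omega
        | combineTwo h1 h2 =>
          subst hg
          rw [Finsupp.single_apply] at h1 h2
          split_ifs at h1 h2 <;> omega
      rw [key]
      exact w
  · refine .intro _ S ?_ l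
    convert ZMove.split (Finsupp.single (j + 4) 1 + Finsupp.single (j + 1) 1) (j + 3)
        (by omega) (by simp) using 1
    ext k
    simp only [hS, Finsupp.add_apply, Finsupp.tsub_apply, Finsupp.single_apply]
    split_ifs <;> omega
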